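/- For all natural numbers p ≥ n·z and q ≥ r ≥ 1, the number of words w over Γ with ||w|| = p + q + n·z, |w|_{b_i} = n_i for each i, and having a prefix of weight exactly p, equals the number of such words having a prefix of weight exactly p + r. -/

import Mathlib

/-- The alphabet `Γ = {a, b₁, …, bₘ}`: `none` encodes the letter `a`, and
`some i` encodes the letter `bᵢ`. -/
abbrev Letter (m : ℕ) := Option (Fin m)

/-- The grading of letters: `‖a‖ = 1` and `‖bᵢ‖ = zᵢ + 1`. -/
def letterWt {m : ℕ} (z : Fin m → ℕ) : Letter m → ℕ
  | none => 1
  | some i => z i + 1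

/-- The weight `‖w‖` of a word: the sum of the weights of its letters. -/
def wordWt {m : ℕ} (z : Fin m → ℕ) (w : List (Letter m)) : ℕ :=
  (w.map (letterWt z)).sum

/-- The dot product `k·z = k₁z₁ + ⋯ + kₘzₘ` of multi-indices. -/
def mdot {m : ℕ} (k z : Fin m → ℕ) : ℕ := ∑ i, k i * z i

theorem wordWt_cons {m : ℕ} (z : Fin m → ℕ) (l : Letter m) (w : List (Letter m)) :
    wordWt z (l :: w) = letterWt z l + wordWt z w := by
  simp [wordWt]

theorem wordWt_append {m : ℕ} (z : Fin m → ℕ) (u v : List (Letter m)) :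
    wordWt z (u ++ v) = wordWt z u + wordWt z v := by
  simp [wordWt]

theorem wordWt_reverse {m : ℕ} (z : Fin m → ℕ) (w : List (Letter m)) :
    wordWt z w.reverse = wordWt z w := by
  simp [wordWt, List.sum_reverse]

theorem letterWt_pos {m : ℕ} (z : Fin m → ℕ) (l : Letter m) : 0 < letterWt z l := by
  cases l <;> simp [letterWt]

theorem eq_nil_of_wordWt_eq_zero {m : ℕ} {z : Fin m → ℕ} {w : List (Letter m)}
    (h : wordWt z w = 0) : w = [] := by
  cases w with
  | nil => rfl
  | cons l w =>
    have := letterWt_pos z l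
    rw [wordWt_cons] at h
    omega

theorem List.IsPrefix.eq_of_wordWt_eq {m : ℕ} {z : Fin m → ℕ} {u v : List (Letter m)}
    (h : u <+: v) (hw : wordWt z u = wordWt z v) : u = v := by
  obtain ⟨t, rfl⟩ := h
  rw [wordWt_append] at hw
  simp [eq_nil_of_wordWt_eq_zero (z := z) (w := t) (by omega)]

theorem eq_of_isPrefix_of_wordWt_eq {m : ℕ} {z : Fin m → ℕ} {u v w : List (Letter m)}
    (hu : u <+: w) (hv : v <+: w) (h : wordWt z u = wordWt z v) : u = v := by
  rcases List.prefix_or_prefix_of_prefix hu hv with huv | hvu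
  · exact huv.eq_of_wordWt_eq h
  · exact (hvu.eq_of_wordWt_eq h.symm).symm

/-- Pairs of words of weights `p` and `q` which together contain `n i` letters `bᵢ`. -/
def wordPairs {m : ℕ} (z n : Fin m → ℕ) (p q : ℕ) : Set (List (Letter m) × List (Letter m)) :=
  {x | wordWt z x.1 = p ∧ wordWt z x.2 = q ∧
    ∀ i, x.1.count (some i) + x.2.count (some i) = n i}

/-- Cutting a word at the prefix of weight `p`; the first component is that prefix reversed. -/
noncomputable def wordPairsEquiv {m : ℕ} (z n : Fin m → ℕ) (p q : ℕ) :
    wordPairs z n p q ≃ {w : List (Letter m) //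
      wordWt z w = p + q ∧ (∀ i, w.count (some i) = n i) ∧
      ∃ u : List (Letter m), u <+: w ∧ wordWt z u = p} :=
  Equiv.ofBijective
    (fun x => ⟨x.1.1.reverse ++ x.1.2, by
      obtain ⟨⟨u, v⟩, hu, hv, h⟩ := x
      refine ⟨?_, ?_, u.reverse, List.prefix_append _ _, ?_⟩
      · rw [wordWt_append, wordWt_reverse]
        exact congrArg₂ (· + ·) hu hv
      · simpa using h
      · exact (wordWt_reverse z u).trans hu⟩) (by
    constructor
    · rintro ⟨⟨u, v⟩, hu, hv, h⟩ ⟨⟨u', v'⟩, hu', hv', h'⟩ heq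
      have heq : u.reverse ++ v = u'.reverse ++ v' := congrArg Subtype.val heq
      have hr : u.reverse = u'.reverse := by
        refine eq_of_isPrefix_of_wordWt_eq (z := z) (List.prefix_append _ v)
          (heq ▸ List.prefix_append _ v') ?_
        rw [wordWt_reverse, wordWt_reverse]
        exact hu.trans hu'.symm
      rw [hr] at heq
      exact Subtype.ext (Prod.ext (List.reverse_injective hr) (List.append_cancel_left heq))
    · rintro ⟨w, hw, h, u, ⟨v, rfl⟩, hu⟩
      rw [wordWt_append] at hw
      refine ⟨⟨(u.reverse, v), ?_, ?_, ?_⟩, ?_⟩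
      · simpa [wordWt_reverse] using hu
      · change wordWt z v = q
        omega
      · simpa using h
      · simp)

/-- Splitting pairs by the first letter of the second component. -/
noncomputable def wordPairsSuccRight {m : ℕ} (z n : Fin m → ℕ) (p q : ℕ) :
    (Σ l : Letter m, {x : List (Letter m) × List (Letter m) //
      (x.1, l :: x.2) ∈ wordPairs z n p (q + 1)}) ≃ wordPairs z n p (q + 1) :=
  Equiv.ofBijective (fun x => ⟨(x.2.1.1, x.1 :: x.2.1.2), x.2.2⟩) (by
    constructor
    · rintro ⟨l, ⟨u, v⟩, h⟩ ⟨l', ⟨u', v'⟩, h'⟩ heq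
      simp only [Subtype.mk.injEq, Prod.mk.injEq, List.cons.injEq] at heq
      obtain ⟨rfl, rfl, rfl⟩ := heq
      rfl
    · rintro ⟨⟨u, v⟩, h⟩
      cases v with
      | nil => simp [wordPairs, wordWt] at h
      | cons l v => exact ⟨⟨l, (u, v), h⟩, rfl⟩)

theorem swap_mem_wordPairs {m : ℕ} {z n : Fin m → ℕ} {p q : ℕ}
    {x : List (Letter m) × List (Letter m)} :
    x.swap ∈ wordPairs z n q p ↔ x ∈ wordPairs z n p q := by
  simp only [wordPairs, Set.mem_ofPred_eq, Prod.fst_swap, Prod.snd_swap]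
  simp only [add_comm (x.2.count _)]
  tauto

/-- Exchanging the two components of a pair. -/
def wordPairsSwap {m : ℕ} (z n : Fin m → ℕ) (p q : ℕ) :
    wordPairs z n p q ≃ wordPairs z n q p :=
  (Equiv.prodComm _ _).subtypeEquiv fun _ => swap_mem_wordPairs.symm

theorem mdot_add_single {m : ℕ} (z n : Fin m → ℕ) (i : Fin m) :
    mdot (n + Pi.single i 1) z = mdot n z + z i := by
  simp [mdot, add_mul, Finset.sum_add_distrib, Pi.single_apply]

theorem cons_none_mem_wordPairs {m : ℕ} {z n : Fin m → ℕ} {p q : ℕ}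
    {u v : List (Letter m)} :
    (u, none :: v) ∈ wordPairs z n p (q + 1) ↔ (u, v) ∈ wordPairs z n p q := by
  simp [wordPairs, wordWt_cons, letterWt, add_comm 1]

theorem cons_some_mem_wordPairs {m : ℕ} {z n : Fin m → ℕ} {p q : ℕ} {i : Fin m}
    {u v : List (Letter m)} :
    (u, some i :: v) ∈ wordPairs z (n + Pi.single i 1) p (q + z i + 1) ↔
      (u, v) ∈ wordPairs z n p q := by
  have hw : z i + 1 + wordWt z v = q + z i + 1 ↔ wordWt z v = q := by omega
  simp only [wordPairs, Set.mem_ofPred_eq, wordWt_cons, letterWt, hw]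
  refine and_congr_right fun _ => and_congr_right fun _ => forall_congr' fun j => ?_
  rcases eq_or_ne i j with rfl | hij
  · simp
    omega
  · simp [hij, hij.symm]

theorem pos_of_cons_some_mem_wordPairs {m : ℕ} {z n : Fin m → ℕ} {p q : ℕ} {i : Fin m}
    {u v : List (Letter m)} (h : (u, some i :: v) ∈ wordPairs z n p q) : 0 < n i := by
  have := h.2.2 i
  simp at this
  omega

theorem exists_eq_add_single {m : ℕ} {n : Fin m → ℕ} {i : Fin m} (h : 0 < n i) :
    ∃ n' : Fin m → ℕ, n = n' + Pi.single i 1 := by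
  refine ⟨n - Pi.single i 1, funext fun j => ?_⟩
  rcases eq_or_ne i j with rfl | hij
  · simp
    omega
  · simp [hij.symm]

theorem nonempty_wordPairs_equiv {m : ℕ} (z n : Fin m → ℕ) (p q r : ℕ)
    (hp : mdot n z ≤ p) (hq : mdot n z ≤ q) :
    Nonempty (wordPairs z n p (q + r) ≃ wordPairs z n (p + r) q) := by
  induction hN : ∑ i, n i using Nat.strong_induction_on generalizing n p q r with
  | _ N ih =>
  subst hN
  induction r generalizing p with
  | zero => exact ⟨Equiv.refl _⟩
  | succ r ihr =>
    suffices h : ∀ q, mdot n z ≤ q →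
        Nonempty (wordPairs z n p (q + 1) ≃ wordPairs z n (p + 1) q) by
      obtain ⟨e⟩ := h (q + r) (by omega)
      obtain ⟨e'⟩ := ihr (p + 1) (by omega)
      rw [show p + (r + 1) = p + 1 + r by omega]
      exact ⟨e.trans e'⟩
    intro q hq
    have fiber : ∀ l : Letter m, Nonempty (
        {x : List (Letter m) × List (Letter m) // (x.1, l :: x.2) ∈ wordPairs z n p (q + 1)} ≃
        {x : List (Letter m) × List (Letter m) //
          (x.1, l :: x.2) ∈ wordPairs z n q (p + 1)}) := by
      rintro (_ | i)
      · exact ⟨(Equiv.subtypeEquivRight fun _ => cons_none_mem_wordPairs).trans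
          ((wordPairsSwap z n p q).trans
            (Equiv.subtypeEquivRight fun _ => cons_none_mem_wordPairs.symm))⟩
      · by_cases hi : 0 < n i
        · obtain ⟨n, rfl⟩ := exists_eq_add_single hi
          rw [mdot_add_single] at hp hq
          obtain ⟨p, rfl⟩ := Nat.exists_eq_add_of_le' (le_of_add_le_right hp)
          obtain ⟨q, rfl⟩ := Nat.exists_eq_add_of_le' (le_of_add_le_right hq)
          obtain ⟨e⟩ := ih (∑ j, n j) (by simp [Finset.sum_add_distrib]) n p q (z i)
            (by omega) (by omega) rfl
          exact ⟨(Equiv.subtypeEquivRight fun _ => cons_some_mem_wordPairs).trans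
            (e.symm.trans ((wordPairsSwap z n p (q + z i)).trans
              (Equiv.subtypeEquivRight fun _ => cons_some_mem_wordPairs.symm)))⟩
        · have (p q : ℕ) : IsEmpty {x : List (Letter m) × List (Letter m) //
              (x.1, some i :: x.2) ∈ wordPairs z n p q} :=
            ⟨fun x => hi (pos_of_cons_some_mem_wordPairs x.2)⟩
          exact ⟨Equiv.equivOfIsEmpty _ _⟩
    exact ⟨(wordPairsSuccRight z n p q).symm.trans
      ((Equiv.sigmaCongrRight fun l => (fiber l).some).trans
        ((wordPairsSuccRight z n q p).trans (wordPairsSwap z n q (p + 1))))⟩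

/-- For `p ≥ n·z` and `q ≥ r ≥ 1`, the number of words `w` over `Γ` with
`‖w‖ = p + q + n·z`, `|w|_{bᵢ} = nᵢ` for each `i`, and having a prefix of weight
exactly `p` equals the number of such words having a prefix of weight exactly `p + r`, for any `1 ≤ r ≤ q`. -/
theorem card_prefix_p_eq_card_prefix_p_add_r (m : ℕ) (hm : 0 < m) (z n : Fin m → ℕ)
    (p q r : ℕ) (hp : mdot n z ≤ p) (hr : 1 ≤ r) (hq : r ≤ q) :
    Nat.card {w : List (Letter m) //
        wordWt z w = p + q + mdot n z ∧ (∀ i, w.count (some i) = n i) ∧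
        ∃ u : List (Letter m), u <+: w ∧ wordWt z u = p} =
      Nat.card {w : List (Letter m) //
        wordWt z w = p + q + mdot n z ∧ (∀ i, w.count (some i) = n i) ∧
        ∃ u : List (Letter m), u <+: w ∧ wordWt z u = p + r} := by
  obtain ⟨q, rfl⟩ := Nat.exists_eq_add_of_le' hq
  obtain ⟨e⟩ := nonempty_wordPairs_equiv z n p (q + mdot n z) r hp (Nat.le_add_left _ _)
  have h₁ : p + (q + r) + mdot n z = p + (q + mdot n z + r) := by omega
  have h₂ : p + (q + mdot n z + r) = p + r + (q + mdot n z) := by omega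
  rw [h₁, ← Nat.card_congr (wordPairsEquiv z n p _), h₂,
    ← Nat.card_congr (wordPairsEquiv z n (p + r) _)]
  exact Nat.card_congr e
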